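/- Let 𝒢_Lie be a Lie-closed set of n-qubit Pauli strings, let P, Q ∈ 𝒢_Lie commute with each other and be 𝔤-connected with respect to 𝒢_Lie, and let M be an n-qubit Pauli string that is 𝔤-connected to Q with respect to 𝒢_Lie. If either (P anticommutes with M and Q commutes with M) or (P commutes with M and Q anticommutes with M), then there exists R ∈ 𝒢_Lie that anticommutes with each of P, Q, and M. -/

import Mathlib

open Matrix

noncomputable section

/-- The four single-qubit Pauli matrices: I, X, Y, Z. -/
def pauli1 : Fin 4 → Matrix (Fin 2) (Fin 2) ℂ :=
  ![1, !![0, 1; 1, 0], !![0, -Complex.I; Complex.I, 0], !![1, 0; 0, -1]]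

/-- The `n`-qubit Pauli string determined by `f : Fin n → Fin 4`. -/
def PauliString (n : ℕ) (f : Fin n → Fin 4) :
    Matrix (Fin n → Fin 2) (Fin n → Fin 2) ℂ :=
  fun x y => ∏ i, pauli1 (f i) (x i) (y i)

/-- Two matrices commute. -/
def MComm {n : ℕ} (A B : Matrix (Fin n → Fin 2) (Fin n → Fin 2) ℂ) : Prop :=
  A * B = B * A

/-- Two matrices anticommute. -/
def MAntiComm {n : ℕ} (A B : Matrix (Fin n → Fin 2) (Fin n → Fin 2) ℂ) : Prop :=
  A * B = -(B * A)

/-- A matrix is an `n`-qubit Pauli string. -/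
def IsPauli {n : ℕ} (A : Matrix (Fin n → Fin 2) (Fin n → Fin 2) ℂ) : Prop :=
  ∃ f : Fin n → Fin 4, A = PauliString n f

/-- A set of `n`-qubit Pauli strings is Lie-closed: whenever two of its members
anticommute, the (unique) Pauli string appearing, up to a unit scalar, in their
product also belongs to the set. -/
def LieClosed {n : ℕ} (𝒢 : Set (Matrix (Fin n → Fin 2) (Fin n → Fin 2) ℂ)) : Prop :=
  ∀ P ∈ 𝒢, ∀ Q ∈ 𝒢, MAntiComm P Q →
    ∀ (c : ℂ) (R : Matrix (Fin n → Fin 2) (Fin n → Fin 2) ℂ),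
      ‖c‖ = 1 → IsPauli R → P * Q = c • R → R ∈ 𝒢

/-- `P` and `Q` are `𝔤`-connected with respect to `𝒢`: they are distinct and
joined by a chain of anticommutations passing through elements of `𝒢`
(the empty chain meaning that `P` and `Q` themselves anticommute). -/
def GConnected {n : ℕ} (𝒢 : Set (Matrix (Fin n → Fin 2) (Fin n → Fin 2) ℂ))
    (P Q : Matrix (Fin n → Fin 2) (Fin n → Fin 2) ℂ) : Prop :=
  P ≠ Q ∧ ∃ l : List (Matrix (Fin n → Fin 2) (Fin n → Fin 2) ℂ),
    (∀ R ∈ l, R ∈ 𝒢) ∧ List.Chain' MAntiComm (P :: (l ++ [Q]))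

lemma pauli1_mul_self (a : Fin 4) : pauli1 a * pauli1 a = 1 := by
  fin_cases a <;> ext i j <;> fin_cases i <;> fin_cases j <;>
    simp [pauli1, Matrix.mul_apply, Fin.sum_univ_two]

lemma pauli1_mul_swap (a b : Fin 4) :
    ∃ s : ℤˣ, pauli1 a * pauli1 b = ((s : ℤ) : ℂ) • (pauli1 b * pauli1 a) := by
  by_cases h : a = 0 ∨ b = 0 ∨ a = b
  · refine ⟨1, ?_⟩
    rcases h with rfl | rfl | rfl <;> simp [pauli1]
  · refine ⟨-1, ?_⟩
    revert h
    fin_cases a <;> fin_cases b <;> intro h <;> simp at h <;>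
      ext i j <;> fin_cases i <;> fin_cases j <;>
        simp [pauli1, Matrix.mul_apply, Fin.sum_univ_two]

lemma pauli1_mul (a b : Fin 4) :
    ∃ (c : ℂ) (d : Fin 4), ‖c‖ = 1 ∧ pauli1 a * pauli1 b = c • pauli1 d := by
  let d : Fin 4 → Fin 4 → Fin 4 :=
    ![![0, 1, 2, 3], ![1, 0, 3, 2], ![2, 3, 0, 1], ![3, 2, 1, 0]]
  let c : Fin 4 → Fin 4 → ℂ :=
    ![![1, 1, 1, 1], ![1, 1, Complex.I, -Complex.I], ![1, -Complex.I, 1, Complex.I],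
      ![1, Complex.I, -Complex.I, 1]]
  refine ⟨c a b, d a b, ?_, ?_⟩
  · fin_cases a <;> fin_cases b <;> simp [c]
  · fin_cases a <;> fin_cases b <;>
      ext i j <;> fin_cases i <;> fin_cases j <;>
        simp [pauli1, c, d, Matrix.mul_apply, Fin.sum_univ_two]

section

variable {n : ℕ} {A B C D : Matrix (Fin n → Fin 2) (Fin n → Fin 2) ℂ}

lemma PauliString_mul_apply (f g : Fin n → Fin 4) (x y : Fin n → Fin 2) :
    (PauliString n f * PauliString n g) x y =
      ∏ i, (pauli1 (f i) * pauli1 (g i)) (x i) (y i) := by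
  simp only [Matrix.mul_apply, PauliString, ← Finset.prod_mul_distrib]
  rw [Finset.prod_univ_sum, Fintype.piFinset_univ]

lemma IsPauli.mul_self (hA : IsPauli A) : A * A = 1 := by
  obtain ⟨f, rfl⟩ := hA
  ext x y
  rw [PauliString_mul_apply]
  simp only [pauli1_mul_self, Matrix.one_apply, Finset.prod_ite_zero, funext_iff]
  simp

lemma IsPauli.comm_or_antiComm (hA : IsPauli A) (hB : IsPauli B) :
    MComm A B ∨ MAntiComm A B := by
  obtain ⟨f, rfl⟩ := hA
  obtain ⟨g, rfl⟩ := hB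
  choose s hs using fun i => pauli1_mul_swap (f i) (g i)
  have h : PauliString n f * PauliString n g =
      (((∏ i, s i : ℤˣ) : ℤ) : ℂ) • (PauliString n g * PauliString n f) := by
    ext x y
    simp only [Matrix.smul_apply, PauliString_mul_apply, hs, smul_eq_mul,
      Finset.prod_mul_distrib, Units.coe_prod, Int.cast_prod]
  rcases Int.units_eq_one_or (∏ i, s i) with h1 | h1 <;> rw [h1] at h
  · left; simpa [MComm] using h
  · right; simpa [MAntiComm] using h

lemma IsPauli.exists_mul_eq_smul (hA : IsPauli A) (hB : IsPauli B) :
    ∃ (c : ℂ) (C : Matrix (Fin n → Fin 2) (Fin n → Fin 2) ℂ),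
      ‖c‖ = 1 ∧ IsPauli C ∧ A * B = c • C := by
  obtain ⟨f, rfl⟩ := hA
  obtain ⟨g, rfl⟩ := hB
  choose c d hc hd using fun i => pauli1_mul (f i) (g i)
  refine ⟨∏ i, c i, PauliString n d, by simp [norm_prod, hc], ⟨d, rfl⟩, ?_⟩
  ext x y
  simp only [Matrix.smul_apply, PauliString_mul_apply, hd, smul_eq_mul,
    Finset.prod_mul_distrib, PauliString]

lemma MComm.symm (h : MComm A B) : MComm B A := Eq.symm h

lemma MAntiComm.symm (h : MAntiComm A B) : MAntiComm B A := by
  unfold MAntiComm at *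
  rw [h, neg_neg]

lemma MComm.not_antiComm (h : MComm A B) (hA : IsPauli A) (hB : IsPauli B) :
    ¬ MAntiComm A B := by
  intro h'
  unfold MComm at h
  unfold MAntiComm at h'
  have h0 : A * B = 0 := by
    ext x y
    rw [← h] at h'
    exact self_eq_neg.mp (congrFun₂ h' x y)
  have h1 : (1 : Matrix (Fin n → Fin 2) (Fin n → Fin 2) ℂ) = 0 := by
    calc 1 = A * (A * B) * B := by
          rw [← Matrix.mul_assoc, hA.mul_self, Matrix.one_mul, hB.mul_self]
      _ = 0 := by rw [h0, Matrix.mul_zero, Matrix.zero_mul]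
  exact one_ne_zero h1

lemma MComm.antiComm_of_mul_eq_smul {c : ℂ} (hA : MComm D A) (hB : MAntiComm D B)
    (hc : ‖c‖ = 1) (h : A * B = c • C) : MAntiComm D C := by
  have hc0 : c ≠ 0 := by
    rintro rfl
    simp at hc
  unfold MComm at hA
  unfold MAntiComm at *
  apply smul_right_injective _ hc0
  change c • (D * C) = c • -(C * D)
  rw [smul_neg, ← Matrix.mul_smul, ← Matrix.smul_mul, ← h, ← Matrix.mul_assoc, hA,
    Matrix.mul_assoc, hB, Matrix.mul_neg, Matrix.mul_assoc]

lemma MAntiComm.antiComm_of_mul_eq_smul {c : ℂ} (hA : MAntiComm D A) (hB : MComm D B)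
    (hc : ‖c‖ = 1) (h : A * B = c • C) : MAntiComm D C := by
  have hc0 : c ≠ 0 := by
    rintro rfl
    simp at hc
  unfold MComm at hB
  unfold MAntiComm at *
  apply smul_right_injective _ hc0
  change c • (D * C) = c • -(C * D)
  rw [smul_neg, ← Matrix.mul_smul, ← Matrix.smul_mul, ← h, ← Matrix.mul_assoc, hA,
    Matrix.neg_mul, Matrix.mul_assoc, hB, Matrix.mul_assoc]

lemma MAntiComm.self_of_mul_eq_smul {c : ℂ} (hAB : MAntiComm A B)
    (hc : ‖c‖ = 1) (h : A * B = c • C) : MAntiComm B C :=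
  hAB.symm.antiComm_of_mul_eq_smul rfl hc h

/-- A chain of anticommutations through a Lie-closed set can be shortened to at most
one intermediate element. -/
lemma LieClosed.antiComm_or_exists_of_chain
    {𝒢 : Set (Matrix (Fin n → Fin 2) (Fin n → Fin 2) ℂ)}
    (h𝒢 : ∀ A ∈ 𝒢, IsPauli A) (hlie : LieClosed 𝒢) (hB : IsPauli B)
    (l : List (Matrix (Fin n → Fin 2) (Fin n → Fin 2) ℂ)) (hl : ∀ R ∈ l, R ∈ 𝒢)
    (hA : IsPauli A) (hchain : List.IsChain MAntiComm (A :: (l ++ [B]))) :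
    MAntiComm A B ∨ ∃ R ∈ 𝒢, MAntiComm A R ∧ MAntiComm B R := by
  induction l generalizing A with
  | nil => left; simpa using hchain
  | cons R l ih =>
    rw [List.cons_append, List.isChain_cons_cons] at hchain
    have hR : R ∈ 𝒢 := hl R (by simp)
    right
    rcases (h𝒢 R hR).comm_or_antiComm hB with hRB | hRB
    · obtain h | ⟨S, hS, hRS, hBS⟩ := ih (fun T hT => hl T (by simp [hT])) (h𝒢 R hR) hchain.2
      · exact absurd h (hRB.not_antiComm (h𝒢 R hR) hB)
      rcases hA.comm_or_antiComm (h𝒢 S hS) with hAS | hAS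
      · obtain ⟨c, T, hc, hT, hmul⟩ := (h𝒢 R hR).exists_mul_eq_smul (h𝒢 S hS)
        exact ⟨T, hlie R hR S hS hRS c T hc hT hmul,
          hchain.1.antiComm_of_mul_eq_smul hAS hc hmul,
          hRB.symm.antiComm_of_mul_eq_smul hBS hc hmul⟩
      · exact ⟨S, hS, hAS, hBS⟩
    · exact ⟨R, hR, hchain.1, hRB.symm⟩

end

/-- **Lemma 9.** Let `P, Q ∈ 𝒢` commute and be `𝔤`-connected, and
let `M` be a Pauli string `𝔤`-connected to `Q`. If exactly one of `P`, `Q`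
anticommutes with `M` (the other commuting with `M`), then some `R ∈ 𝒢`
anticommutes with each of `P`, `Q`, and `M`. -/
theorem exists_R_anticommuting_with_all
    {n : ℕ} (hn : 1 ≤ n)
    (𝒢 : Set (Matrix (Fin n → Fin 2) (Fin n → Fin 2) ℂ))
    (h𝒢pauli : ∀ A ∈ 𝒢, IsPauli A) (h𝒢lie : LieClosed 𝒢)
    (P Q M : Matrix (Fin n → Fin 2) (Fin n → Fin 2) ℂ)
    (hP : P ∈ 𝒢) (hQ : Q ∈ 𝒢) (hM : IsPauli M)
    (hPQ : MComm P Q) (hconnPQ : GConnected 𝒢 P Q)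
    (hconnQM : GConnected 𝒢 Q M)
    (hcase : (MAntiComm P M ∧ MComm Q M) ∨ (MComm P M ∧ MAntiComm Q M)) :
    ∃ R ∈ 𝒢, MAntiComm P R ∧ MAntiComm Q R ∧ MAntiComm M R := by
  obtain ⟨-, l, hl, hchain⟩ := hconnPQ
  have hPp := h𝒢pauli P hP
  have hQp := h𝒢pauli Q hQ
  obtain h | ⟨R, hR, hPR, hQR⟩ :=
    h𝒢lie.antiComm_or_exists_of_chain h𝒢pauli hQp l hl hPp hchain
  · exact absurd h (hPQ.not_antiComm hPp hQp)
  have hRp := h𝒢pauli R hR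
  rcases hM.comm_or_antiComm hRp with hMR | hMR
  · rcases hcase with ⟨hPM, -⟩ | ⟨-, hQM⟩
    · obtain ⟨c, S, hc, hS, hmul⟩ := hRp.exists_mul_eq_smul hPp
      exact ⟨S, h𝒢lie R hR P hP hPR.symm c S hc hS hmul,
        hPR.symm.self_of_mul_eq_smul hc hmul,
        hQR.antiComm_of_mul_eq_smul hPQ.symm hc hmul,
        hMR.antiComm_of_mul_eq_smul hPM.symm hc hmul⟩
    · obtain ⟨c, S, hc, hS, hmul⟩ := hRp.exists_mul_eq_smul hQp
      exact ⟨S, h𝒢lie R hR Q hQ hQR.symm c S hc hS hmul,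
        hPR.antiComm_of_mul_eq_smul hPQ hc hmul,
        hQR.symm.self_of_mul_eq_smul hc hmul,
        hMR.antiComm_of_mul_eq_smul hQM.symm hc hmul⟩
  · exact ⟨R, hR, hPR, hQR, hMR⟩
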